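/- Skeptical acceptance transfer for the ADF-grounded semantics: For any ADF F = (A,R,C), any MMA G ∈ f_α({F}) and any a ∈ A, assuming Θ^G has a ⪯-least fixpoint λ_G and Θ^F has a ⪯-least fixpoint λ_F, if a is skeptically accepted (resp. skeptically rejected) with respect to {λ_G}, then a is skeptically accepted (resp. skeptically rejected) with respect to {λ_F}. -/

import Mathlib

inductive Label : Type
  | inn
  | out
  | undec
deriving DecidableEq

instance instFintypeLabel : Fintype Label where
  elems := {Label.inn, Label.out, Label.undec}
  complete := by intro x; cases x <;> simp

inductive Kind : Type
  | must
  | mays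
  | nott
deriving DecidableEq

structure Nuance : Type where
  n1 : ℕ
  n2 : ℕ
  m1 : ℕ
  m2 : ℕ
  hn : n1 ≤ n2
  hm : m1 ≤ m2

variable {A : Type} [Fintype A] [DecidableEq A]

/-- The set of attackers of `a`. -/
def pre (R : A → A → Prop) [DecidableRel R] (a : A) : Finset A :=
  Finset.univ.filter (fun b => R b a)

/-- Number of `out`-labelled arguments in the domain of a labelling. -/
def oCount {S : Finset A} (lam : ↥S → Label) : ℕ :=
  (Finset.univ.filter (fun b : ↥S => lam b = Label.out)).card

/-- Number of `in`-labelled arguments in the domain of a labelling. -/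
def iCount {S : Finset A} (lam : ↥S → Label) : ℕ :=
  (Finset.univ.filter (fun b : ↥S => lam b = Label.inn)).card

/-- `x`-acceptance conditions for `x ∈ {must, may_s, not}`. -/
def satA (Q : Nuance) (o : ℕ) : Kind → Prop
  | Kind.must => Q.n2 ≤ o
  | Kind.mays => Q.n1 ≤ o ∧ o < Q.n2
  | Kind.nott => o < Q.n1

/-- `y`-rejection conditions for `y ∈ {must, may_s, not}`. -/
def satR (Q : Nuance) (i : ℕ) : Kind → Prop
  | Kind.must => Q.m2 ≤ i
  | Kind.mays => Q.m1 ≤ i ∧ i < Q.m2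
  | Kind.nott => i < Q.m1

/-- Label designation as a function of the nuance tuple and the counts `o`, `i`. -/
def designatesN (Q : Nuance) (o i : ℕ) (l : Label) : Prop :=
  (l = Label.inn ∧ Q.n1 ≤ o ∧ ¬ Q.m2 ≤ i) ∨
  (l = Label.out ∧ Q.m1 ≤ i ∧ ¬ Q.n2 ≤ o) ∨
  (l = Label.undec ∧
    ((Q.n2 ≤ o ∧ Q.m2 ≤ i) ∨
     ((Q.n1 ≤ o ∧ o < Q.n2) ∨ (Q.m1 ≤ i ∧ i < Q.m2)) ∨
     (o < Q.n1 ∧ i < Q.m1)))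

/-- `lam` designates `l` for `a` in the MMA `(A, R, fQ)`. -/
def designatesMMA (R : A → A → Prop) [DecidableRel R] (fQ : A → Nuance)
    (a : A) (lam : ↥(pre R a) → Label) (l : Label) : Prop :=
  designatesN (fQ a) (oCount lam) (iCount lam) l

/-- The ADF `(A, R, C)` is a concretisation of the MMA `(A, R, fQ)`. -/
def IsConcretisation (R : A → A → Prop) [DecidableRel R]
    (C : ∀ a : A, (↥(pre R a) → Label) → Label) (fQ : A → Nuance) : Prop :=
  ∀ (a : A) (lam : ↥(pre R a) → Label), designatesMMA R fQ a lam (C a lam)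

/-- Γ[fQ]: the set of all concretisations of the MMA `(A, R, fQ)`. -/
def Gamma (R : A → A → Prop) [DecidableRel R] (fQ : A → Nuance) :
    Set (∀ a : A, (↥(pre R a) → Label) → Label) :=
  {C | IsConcretisation R C fQ}

/-- The MMA `(A, R, fQ)` is an abstraction of the ADF `(A, R, C)`. -/
def IsAbstraction (R : A → A → Prop) [DecidableRel R] (fQ : A → Nuance)
    (C : ∀ a : A, (↥(pre R a) → Label) → Label) : Prop :=
  ∀ a : A,
    (fQ a).n2 ≤ (pre R a).card + 1 ∧ (fQ a).m2 ≤ (pre R a).card + 1 ∧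
    ∀ lam : ↥(pre R a) → Label,
      (oCount lam < (fQ a).n1 → iCount lam < (fQ a).m1 → C a lam = Label.undec) ∧
      ((fQ a).n1 ≤ oCount lam → oCount lam < (fQ a).n2 → iCount lam < (fQ a).m1 →
        (C a lam = Label.inn ∨ C a lam = Label.undec)) ∧
      ((fQ a).n2 ≤ oCount lam → iCount lam < (fQ a).m1 → C a lam = Label.inn) ∧
      (oCount lam < (fQ a).n1 → (fQ a).m1 ≤ iCount lam → iCount lam < (fQ a).m2 →
        (C a lam = Label.out ∨ C a lam = Label.undec)) ∧
      ((fQ a).n1 ≤ oCount lam → oCount lam < (fQ a).n2 → (fQ a).m1 ≤ iCount lam →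
        iCount lam < (fQ a).m2 →
        (C a lam = Label.inn ∨ C a lam = Label.out ∨ C a lam = Label.undec)) ∧
      ((fQ a).n2 ≤ oCount lam → (fQ a).m1 ≤ iCount lam → iCount lam < (fQ a).m2 →
        (C a lam = Label.inn ∨ C a lam = Label.undec)) ∧
      (oCount lam < (fQ a).n1 → (fQ a).m2 ≤ iCount lam → C a lam = Label.out) ∧
      ((fQ a).n1 ≤ oCount lam → oCount lam < (fQ a).n2 → (fQ a).m2 ≤ iCount lam →
        (C a lam = Label.out ∨ C a lam = Label.undec)) ∧
      ((fQ a).n2 ≤ oCount lam → (fQ a).m2 ≤ iCount lam → C a lam = Label.undec)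

/-- Δ[C]: the set of all abstractions of the ADF `(A, R, C)`. -/
def Delta (R : A → A → Prop) [DecidableRel R]
    (C : ∀ a : A, (↥(pre R a) → Label) → Label) : Set (A → Nuance) :=
  {fQ | IsAbstraction R fQ C}

/-- The abstract order `⊴` on nuance tuples. -/
def nuanceLE (Q Q' : Nuance) : Prop :=
  Q'.n1 ≤ Q.n1 ∧ Q.n2 ≤ Q'.n2 ∧ Q'.m1 ≤ Q.m1 ∧ Q.m2 ≤ Q'.m2

/-- The abstract order `⊑` on MMAs over the same `(A, R)`. -/
def mmaLE (fQ fQ' : A → Nuance) : Prop := ∀ a : A, nuanceLE (fQ a) (fQ' a)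

/-- Strict abstract order `⊏` on MMAs. -/
def mmaLT (fQ fQ' : A → Nuance) : Prop := mmaLE fQ fQ' ∧ ¬ mmaLE fQ' fQ

/-- The order `⊑` on sets of MMAs. -/
def setLE (X' X : Set (A → Nuance)) : Prop := ∀ G ∈ X', ∃ F ∈ X, mmaLE G F

/-- `f_γ` on sets of MMAs. -/
def fGamma (R : A → A → Prop) [DecidableRel R] (X : Set (A → Nuance)) :
    Set (∀ a : A, (↥(pre R a) → Label) → Label) :=
  ⋃ fQ ∈ X, Gamma R fQ

/-- `f_α` on sets of ADFs. -/
def fAlpha (R : A → A → Prop) [DecidableRel R]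
    (Y : Set (∀ a : A, (↥(pre R a) → Label) → Label)) : Set (A → Nuance) :=
  ⋃ C ∈ Y, {fQ | fQ ∈ Delta R C ∧ ¬ ∃ fQ' ∈ Delta R C, mmaLT fQ' fQ}

/-- `f_α({C})` for a single ADF. -/
def fAlphaSingle (R : A → A → Prop) [DecidableRel R]
    (C : ∀ a : A, (↥(pre R a) → Label) → Label) : Set (A → Nuance) :=
  {fQ | fQ ∈ Delta R C ∧ ¬ ∃ fQ' ∈ Delta R C, mmaLT fQ' fQ}

/-- Restriction of a total labelling to `pre(a)`. -/
def restrictTo (R : A → A → Prop) [DecidableRel R] (lam : A → Label) (a : A) :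
    ↥(pre R a) → Label :=
  fun b => lam b.1

/-- `lam` is an exact labelling of the MMA `(A, R, fQ)`. -/
def ExactMMA (R : A → A → Prop) [DecidableRel R] (fQ : A → Nuance)
    (lam : A → Label) : Prop :=
  ∀ a : A, designatesMMA R fQ a (restrictTo R lam a) (lam a)

/-- `lam` is an exact labelling of the ADF `(A, R, C)`. -/
def ExactADF (R : A → A → Prop) [DecidableRel R]
    (C : ∀ a : A, (↥(pre R a) → Label) → Label) (lam : A → Label) : Prop :=
  ∀ a : A, C a (restrictTo R lam a) = lam a

/-- The order `⪯` on total labellings. -/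
def preceq (lam1 lam2 : A → Label) : Prop :=
  ∀ a : A, (lam1 a = Label.inn → lam2 a = Label.inn) ∧
    (lam1 a = Label.out → lam2 a = Label.out)

/-- `maxi_A(lam)`: the maximal labellings above `lam` in `⪯`. -/
def maxi (lam : A → Label) : Set (A → Label) :=
  {lx | preceq lam lx ∧ ∀ ly : A → Label, preceq lx ly → preceq ly lx}

/-- Total-labelling designation in an MMA. -/
def desMMAtotal (R : A → A → Prop) [DecidableRel R] (fQ : A → Nuance)
    (a : A) (lam : A → Label) (l : Label) : Prop :=
  designatesMMA R fQ a (restrictTo R lam a) l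

/-- Total-labelling designation in an ADF. -/
def desADFtotal (R : A → A → Prop) [DecidableRel R]
    (C : ∀ a : A, (↥(pre R a) → Label) → Label)
    (a : A) (lam : A → Label) (l : Label) : Prop :=
  C a (restrictTo R lam a) = l

open Classical in
/-- The consensus operator `Θ^H`, parameterised by the designation relation of `H`. -/
noncomputable def theta (D : A → (A → Label) → Label → Prop) (lam : A → Label) :
    A → Label :=
  fun a =>
    if ∀ lx ∈ maxi lam, D a lx Label.inn ∧ ∀ l : Label, D a lx l → l = Label.inn then
      Label.inn
    else if ∀ lx ∈ maxi lam, D a lx Label.out ∧ ∀ l : Label, D a lx l → l = Label.out then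
      Label.out
    else Label.undec

/-- `lam` is a `⪯`-least fixpoint of `Th`. -/
def IsLfp (Th : (A → Label) → (A → Label)) (lam : A → Label) : Prop :=
  Th lam = lam ∧ ∀ mu : A → Label, Th mu = mu → preceq lam mu

/-- `a` is credulously accepted/rejected (label `l`) w.r.t. the set `S` of labellings. -/
def CredIn (S : Set (A → Label)) (a : A) (l : Label) : Prop :=
  ∃ lam ∈ S, lam a = l

/-- `a` is skeptically accepted/rejected (label `l`) w.r.t. the set `S` of labellings. -/
def SkepIn (S : Set (A → Label)) (a : A) (l : Label) : Prop :=
  CredIn S a l ∧ ∀ lam ∈ S, lam a = l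

/-- A monotone map on a finite partial order has a fixpoint below each of its pre-fixpoints. -/
theorem exists_fixpoint_le_of_monotone {α : Type*} [PartialOrder α] [Finite α] {f : α → α}
    (hf : Monotone f) {x : α} (hx : f x ≤ x) : ∃ y, y ≤ x ∧ f y = y := by
  obtain ⟨y, hy⟩ := (Set.toFinite {y | y ≤ x ∧ f y ≤ y}).exists_minimal ⟨x, le_rfl, hx⟩
  have hfy : f y ≤ y := hy.prop.2
  exact ⟨y, hy.prop.1, le_antisymm hfy (hy.le_of_le ⟨hfy.trans hy.prop.1, hf hfy⟩ hfy)⟩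

/-- The labellings of `A`, partially ordered by `⪯`. -/
abbrev labellingPartialOrder : PartialOrder (A → Label) where
  le := preceq
  le_refl _ _ := ⟨id, id⟩
  le_trans _ _ _ h h' a := ⟨(h' a).1 ∘ (h a).1, (h' a).2 ∘ (h a).2⟩
  le_antisymm x y h h' := by
    funext a
    have h := h a
    have h' := h' a
    cases hx : x a <;> cases hy : y a <;> simp_all

theorem maxi_nonempty {α : Type} (lam : α → Label) : (maxi lam).Nonempty := by
  refine ⟨fun a => if lam a = Label.undec then Label.inn else lam a, ?_, ?_⟩
  · intro a
    cases h : lam a <;> simp [h]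
  · intro ly h a
    have h := h a
    cases hl : lam a <;> simp_all

theorem maxi_subset {α : Type} {lam mu : α → Label} (h : preceq lam mu) : maxi mu ⊆ maxi lam :=
  fun _ hx => ⟨fun a => ⟨(hx.1 a).1 ∘ (h a).1, (hx.1 a).2 ∘ (h a).2⟩, hx.2⟩

theorem theta_eq_inn_iff {D : A → (A → Label) → Label → Prop} {lam : A → Label} {a : A} :
    theta D lam a = Label.inn ↔
      ∀ lx ∈ maxi lam, D a lx Label.inn ∧ ∀ l : Label, D a lx l → l = Label.inn := by
  unfold theta
  split_ifs with h
  · exact iff_of_true rfl h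
  all_goals exact iff_of_false (by simp) h

theorem theta_eq_out_iff {D : A → (A → Label) → Label → Prop} {lam : A → Label} {a : A} :
    theta D lam a = Label.out ↔
      ∀ lx ∈ maxi lam, D a lx Label.out ∧ ∀ l : Label, D a lx l → l = Label.out := by
  unfold theta
  split_ifs with h h'
  · obtain ⟨lx, hlx⟩ := maxi_nonempty lam
    refine iff_of_false (by simp) fun h' => ?_
    exact absurd ((h' lx hlx).2 _ (h lx hlx).1) (by simp)
  · exact iff_of_true rfl h'
  · exact iff_of_false (by simp) h'

/-- `Θ` is monotone in the labelling and antitone in the (serial) designation relation. -/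
theorem theta_preceq_theta {D E : A → (A → Label) → Label → Prop}
    (hE : ∀ a lx, ∃ l, E a lx l) (hED : ∀ a lx l, E a lx l → D a lx l)
    {lam mu : A → Label} (h : preceq lam mu) : preceq (theta D lam) (theta E mu) := by
  have key : ∀ a l, (∀ lx ∈ maxi lam, D a lx l ∧ ∀ l', D a lx l' → l' = l) →
      ∀ lx ∈ maxi mu, E a lx l ∧ ∀ l', E a lx l' → l' = l := by
    intro a l H lx hlx
    have hD := (H lx (maxi_subset h hlx)).2
    obtain ⟨l₀, hl₀⟩ := hE a lx
    obtain rfl := hD l₀ (hED a lx l₀ hl₀)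
    exact ⟨hl₀, fun l' hl' => hD l' (hED a lx l' hl')⟩
  intro a
  rw [theta_eq_inn_iff, theta_eq_inn_iff, theta_eq_out_iff, theta_eq_out_iff]
  exact ⟨key a _, key a _⟩

theorem exists_designatesN (Q : Nuance) (o i : ℕ) : ∃ l, designatesN Q o i l := by
  by_cases h : designatesN Q o i Label.undec
  · exact ⟨_, h⟩
  · have hn := Q.hn
    have hm := Q.hm
    by_cases h' : Q.n2 ≤ o
    · refine ⟨Label.inn, Or.inl ⟨rfl, ?_⟩⟩
      simp [designatesN] at h
      omega
    · refine ⟨Label.out, Or.inr (Or.inl ⟨rfl, ?_⟩)⟩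
      simp [designatesN] at h
      omega

/-- Every ADF is a concretisation of each of its abstractions. -/
theorem IsAbstraction.isConcretisation {α : Type} [Fintype α] {R : α → α → Prop}
    [DecidableRel R] {fQ : α → Nuance} {C : ∀ a : α, (↥(pre R a) → Label) → Label} (h : IsAbstraction R fQ C) :
    IsConcretisation R C fQ := by
  intro a lam
  obtain ⟨-, -, h⟩ := h a
  have h := h lam
  have hn := (fQ a).hn
  have hm := (fQ a).hm
  unfold designatesMMA designatesN
  cases hC : C a lam <;> simp [hC] at h ⊢ <;> omega

/-- Skeptical acceptance transfer for the ADF-grounded semantics. -/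
theorem skeptical_transfer_grounded (R : A → A → Prop) [DecidableRel R]
    (C : ∀ a : A, (↥(pre R a) → Label) → Label) (fQ : A → Nuance)
    (hG : fQ ∈ fAlphaSingle R C) (a : A) (lamG lamF : A → Label)
    (hlamG : IsLfp (theta (desMMAtotal R fQ)) lamG)
    (hlamF : IsLfp (theta (desADFtotal R C)) lamF) :
    (SkepIn {lamG} a Label.inn → SkepIn {lamF} a Label.inn) ∧
    (SkepIn {lamG} a Label.out → SkepIn {lamF} a Label.out) := by
  have hdes : ∀ a lx l, desADFtotal R C a lx l → desMMAtotal R fQ a lx l := by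
    rintro a lx _ rfl
    exact hG.1.isConcretisation a _
  have hpre : preceq (theta (desMMAtotal R fQ) lamF) lamF := by
    conv_rhs => rw [← hlamF.1]
    exact theta_preceq_theta (fun _ _ => ⟨_, rfl⟩) hdes fun _ => ⟨id, id⟩
  let _ : PartialOrder (A → Label) := labellingPartialOrder
  have hmono : Monotone (theta (desMMAtotal R fQ)) := fun _ _ h =>
    theta_preceq_theta (fun _ _ => exists_designatesN _ _ _) (fun _ _ _ => id) h
  obtain ⟨mu, hmu, hfix⟩ := exists_fixpoint_le_of_monotone hmono hpre
  have hle : preceq lamG lamF := le_trans (hlamG.2 mu hfix) hmu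
  simpa [SkepIn, CredIn] using hle a
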